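/- Let X be a bifurcating Markov chain with kernel P started at X_∅ = x. For all bounded measurable f, g : S → ℝ, every x ∈ S and all integers n ≥ m ≥ 0: E_x[M_{G_n}(f) M_{G_m}(g)] = 2^n Q^m( g · Q^{n−m} f )(x) + Σ_{k=0}^{m−1} 2^{n+k} Q^{m−k−1}( P( Q^k g ⊗_sym Q^{n−m+k} f ) )(x), where (g⊗g')(y,z) = g(y)g'(z) and g ⊗_sym g' = (g⊗g' + g'⊗g)/2. -/

import Mathlib

open MeasureTheory Filter ProbabilityTheory

noncomputable section

namespace BMC

/-- A vertex of the infinite binary tree is a finite word over `{0,1}`. -/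
abbrev Word : Type := List Bool

/-- The `k`-th generation `G_k` of the binary tree. -/
def gen (k : ℕ) : Finset Word :=
  (Finset.univ : Finset (Fin k → Bool)).image fun f => List.ofFn f

/-- The tree `T_k` up to generation `k`. -/
def tree (k : ℕ) : Finset Word := (Finset.range (k + 1)).biUnion gen

/-- The (lexicographic-genealogic) order on the binary tree: `i ≤ j` iff `i` is an
ancestor of `j`, or `v0` is an ancestor of `i` and `v1` an ancestor of `j` for some `v`. -/
def wle (i j : Word) : Prop :=
  i <+: j ∨ ∃ v : Word, (v ++ [false]) <+: i ∧ (v ++ [true]) <+: j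

variable {d : ℕ}

/-- Euclidean norm on `Fin d → ℝ`. -/
def enorm (x : Fin d → ℝ) : ℝ := Real.sqrt (∑ j, x j ^ 2)

/-- Action of the kernel `P` on a function of the pair of children. -/
def Pop (P : Kernel (Fin d → ℝ) ((Fin d → ℝ) × (Fin d → ℝ)))
    (h : (Fin d → ℝ) × (Fin d → ℝ) → ℝ) (x : Fin d → ℝ) : ℝ := ∫ p, h p ∂(P x)

/-- The mean kernel `Q = (P₀ + P₁)/2`, acting on functions. -/
def Qop (P : Kernel (Fin d → ℝ) ((Fin d → ℝ) × (Fin d → ℝ)))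
    (f : (Fin d → ℝ) → ℝ) : (Fin d → ℝ) → ℝ :=
  fun x => (∫ p, (f p.1 + f p.2) ∂(P x)) / 2

/-- The σ-field generated by the chain up to generation `k`. -/
def sigmaUpTo {Ω : Type*} [MeasurableSpace Ω] (X : Word → Ω → (Fin d → ℝ)) (k : ℕ) :
    MeasurableSpace Ω :=
  ⨆ j ∈ tree k, MeasurableSpace.comap (X j) inferInstance

/-- The σ-field `F_i` generated by `X_u` for `u ≤ i` in the tree order. -/
def Fsig {Ω : Type*} [MeasurableSpace Ω] (X : Word → Ω → (Fin d → ℝ)) (i : Word) :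
    MeasurableSpace Ω :=
  ⨆ u ∈ {u : Word | wle u i}, MeasurableSpace.comap (X u) inferInstance

/-- `X` is a bifurcating Markov chain with initial distribution `ν` and kernel `P`. -/
structure IsBMC {Ω : Type*} [MeasurableSpace Ω] (Pr : Measure Ω)
    (X : Word → Ω → (Fin d → ℝ)) (ν : Measure (Fin d → ℝ))
    (P : Kernel (Fin d → ℝ) ((Fin d → ℝ) × (Fin d → ℝ))) : Prop where
  meas : ∀ i, Measurable (X i)
  init : Pr.map (X []) = ν
  branching : ∀ (k : ℕ) (g : Word → (Fin d → ℝ) → (Fin d → ℝ) → (Fin d → ℝ) → ℝ),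
    (∀ i, Measurable fun p : (Fin d → ℝ) × (Fin d → ℝ) × (Fin d → ℝ) => g i p.1 p.2.1 p.2.2) →
    (∀ i, ∃ C, ∀ x y z, |g i x y z| ≤ C) →
    (Pr[(fun ω => ∏ i ∈ gen k, g i (X i ω) (X (i ++ [false]) ω) (X (i ++ [true]) ω))
        | sigmaUpTo X k]
      =ᵐ[Pr] fun ω => ∏ i ∈ gen k, ∫ p, g i (X i ω) p.1 p.2 ∂(P (X i ω)))

/-- Uniform geometric ergodicity of `Q` with invariant measure `μm`, rate `α`, constant `M`. -/
def ErgodicQ (P : Kernel (Fin d → ℝ) ((Fin d → ℝ) × (Fin d → ℝ)))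
    (μm : Measure (Fin d → ℝ)) (M α : ℝ) : Prop :=
  ∀ (f : (Fin d → ℝ) → ℝ) (C : ℝ), Measurable f → (∀ x, |f x| ≤ C) →
    ∀ (n : ℕ) (x : Fin d → ℝ), |(Qop P)^[n] f x - ∫ y, f y ∂μm| ≤ M * α ^ n * C

/-- `μm` is invariant for `Q`. -/
def IsInvariantQ (P : Kernel (Fin d → ℝ) ((Fin d → ℝ) × (Fin d → ℝ)))
    (μm : Measure (Fin d → ℝ)) : Prop :=
  ∀ f : (Fin d → ℝ) → ℝ, Measurable f → (∃ C, ∀ x, |f x| ≤ C) →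
    ∫ x, Qop P f x ∂μm = ∫ x, f x ∂μm

/-- The bandwidth `h_n = 2^{-nγ}`. -/
def bandwidth (γ : ℝ) (n : ℕ) : ℝ := (2 : ℝ) ^ (-(n : ℝ) * γ)

/-- The kernel density estimator `μ̂_{A}(x)` built from observations indexed by `A`. -/
def est {Ω : Type*} (K : (Fin d → ℝ) → ℝ) (X : Word → Ω → (Fin d → ℝ)) (γ : ℝ)
    (A : Finset Word) (n : ℕ) (x : Fin d → ℝ) (ω : Ω) : ℝ :=
  (A.card : ℝ)⁻¹ * (bandwidth γ n ^ (d : ℝ))⁻¹ *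
    ∑ u ∈ A, K ((bandwidth γ n)⁻¹ • (x - X u ω))

/-- One-dimensional `k`-th partial derivative of `f` in direction `j` at `x`. -/
def pder (f : (Fin d → ℝ) → ℝ) (j : Fin d) (k : ℕ) (x : Fin d → ℝ) : ℝ :=
  iteratedDeriv k (fun t => f (Function.update x j t)) (x j)

/-- `f` belongs to the isotropic Hölder class of order `s` with constant `L`. -/
def HolderClass (f : (Fin d → ℝ) → ℝ) (s L : ℝ) : Prop :=
  (∀ (j : Fin d) (x : Fin d → ℝ),
      ContDiff ℝ (⌊s⌋₊ : ℕ∞) fun t => f (Function.update x j t)) ∧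
  ∀ (j : Fin d) (x : Fin d → ℝ) (t : ℝ),
    |pder f j ⌊s⌋₊ (Function.update x j t) - pder f j ⌊s⌋₊ x| ≤
      L * |x j - t| ^ (s - (⌊s⌋₊ : ℝ))

/-- Regularity of the kernel function `K`. -/
def KernelReg (K : (Fin d → ℝ) → ℝ) : Prop :=
  Measurable K ∧ (∃ C, ∀ x, |K x| ≤ C) ∧ Integrable K volume ∧
    Integrable (fun x => K x ^ 2) volume ∧ (∫ x, K x) = 1 ∧
    ∀ ε > 0, ∃ R, ∀ x, R ≤ enorm x → |enorm x * K x| < ε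

/-- `K` is of order `⌊s⌋`. -/
def KernelOrder (K : (Fin d → ℝ) → ℝ) (s : ℝ) : Prop :=
  Integrable (fun x => enorm x ^ s * |K x|) volume ∧
    ∀ (j : Fin d) (k : ℕ), 1 ≤ k → k ≤ ⌊s⌋₊ →
      ∀ x : Fin d → ℝ, (∫ t : ℝ, t ^ k * K (Function.update x j t)) = 0

/-- Conditions (2.7) on the moderate deviation speed `b_n`. -/
def SpeedCond (b : ℕ → ℝ) (γ s : ℝ) (d : ℕ) : Prop :=
  (∀ n, 0 < b n) ∧ Tendsto b atTop atTop ∧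
    Tendsto (fun n : ℕ => (n : ℝ) ^ (3 / 2 : ℝ) * b n /
      Real.sqrt (2 ^ n * bandwidth γ n ^ (d : ℝ))) atTop (nhds 0) ∧
    Tendsto (fun n => b n /
      Real.sqrt (2 ^ n * bandwidth γ n ^ (2 * s + d))) atTop atTop

/-- `W` satisfies a moderate deviation principle with speed `b_n²` and rate function `I`. -/
def MDPseq {E Ω : Type*} [TopologicalSpace E] [MeasurableSpace E] [MeasurableSpace Ω]
    (Pr : Measure Ω) (W : ℕ → Ω → E) (b : ℕ → ℝ) (I : E → ℝ) : Prop :=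
  ∀ A : Set E, MeasurableSet A →
    (-(⨅ y ∈ interior A, (I y : EReal)) ≤
      Filter.liminf
        (fun n => (((b n ^ 2)⁻¹ : ℝ) : EReal) * ENNReal.log (Pr {ω | W n ω ∈ A})) atTop) ∧
    Filter.limsup
        (fun n => (((b n ^ 2)⁻¹ : ℝ) : EReal) * ENNReal.log (Pr {ω | W n ω ∈ A})) atTop ≤
      -(⨅ y ∈ closure A, (I y : EReal))

/-- `f` centered with respect to `μm`. -/
def tilde (μm : Measure (Fin d → ℝ)) (f : (Fin d → ℝ) → ℝ) (x : Fin d → ℝ) : ℝ :=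
  f x - ∫ y, f y ∂μm

/-- `M_A(f) = Σ_{i ∈ A} f(X_i)`. -/
def MA {Ω : Type*} (X : Word → Ω → (Fin d → ℝ)) (A : Finset Word)
    (f : (Fin d → ℝ) → ℝ) (ω : Ω) : ℝ :=
  ∑ i ∈ A, f (X i ω)

/-- Assumption 2.4 on the sequence of functions `𝔣_n = (f_{ℓ,n})`, where `f n ℓ = f_{ℓ,n}`. -/
def FnAssump (P : Kernel (Fin d → ℝ) ((Fin d → ℝ) × (Fin d → ℝ)))
    (μm : Measure (Fin d → ℝ)) (γ : ℝ) (f : ℕ → ℕ → (Fin d → ℝ) → ℝ) (σ2 : ℝ) : Prop :=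
  (∀ n ℓ, Measurable (f n ℓ)) ∧
  (∀ n ℓ, n < ℓ → f n ℓ = 0) ∧
  (∃ C : ℝ, ∀ n : ℕ, ∀ ℓ ≤ n,
    (∀ x, bandwidth γ n ^ ((d : ℝ) / 2) * |f n ℓ x| ≤ C) ∧
    (∀ x, |Qop P (f n ℓ) x| ≤ C * bandwidth γ n ^ ((d : ℝ) / 2)) ∧
    (∀ x, |Qop P (fun y => f n ℓ y ^ 2) x| ≤ C) ∧
    (∀ x, |Pop P (fun q => f n ℓ q.1 * f n ℓ q.2) x| ≤ C * bandwidth γ n ^ (d : ℝ))) ∧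
  (∃ C : ℝ, ∀ n : ℕ, ∀ ℓ ≤ n,
    (∫ x, |f n ℓ x| ∂μm) ≤ C * bandwidth γ n ^ ((d : ℝ) / 2) ∧
    (∫ x, f n ℓ x ^ 2 ∂μm) ≤ C) ∧
  Tendsto (fun n => ∑ ℓ ∈ Finset.range (n + 1), ((2 : ℝ)⁻¹) ^ ℓ * ∫ x, f n ℓ x ^ 2 ∂μm)
    atTop (nhds σ2)

/-- `N_{n,∅}(𝔣_n)`. -/
def Nempty {Ω : Type*} (X : Word → Ω → (Fin d → ℝ)) (μm : Measure (Fin d → ℝ))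
    (f : ℕ → ℕ → (Fin d → ℝ) → ℝ) (n : ℕ) (ω : Ω) : ℝ :=
  (Real.sqrt (2 ^ n))⁻¹ * ∑ ℓ ∈ Finset.range (n + 1), MA X (gen (n - ℓ)) (tilde μm (f n ℓ)) ω

/-- Conditions on the auxiliary sequence `p_n`. -/
def PCond (p : ℕ → ℕ) (b : ℕ → ℝ) : Prop :=
  Monotone p ∧ (∀ n, 1 ≤ p n) ∧ (∀ n, 1 ≤ n → p n ≤ n) ∧
    Tendsto (fun n => (p n : ℝ) ^ 3 * b n ^ 2 / 2 ^ (n - p n : ℕ)) atTop (nhds 0)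

/-- `N_{n,i}(𝔣_n)` for `i ∈ G_{n-p_n}`. -/
def Nni {Ω : Type*} (X : Word → Ω → (Fin d → ℝ)) (μm : Measure (Fin d → ℝ))
    (f : ℕ → ℕ → (Fin d → ℝ) → ℝ) (p : ℕ → ℕ) (n : ℕ) (i : Word) (ω : Ω) : ℝ :=
  (Real.sqrt (2 ^ n))⁻¹ * ∑ ℓ ∈ Finset.range (p n + 1),
    ∑ j ∈ gen (p n - ℓ), tilde μm (f n ℓ) (X (i ++ j) ω)

/-- The martingale increment `Δ_{n,i}(𝔣_n)`. -/
def Dni {Ω : Type*} [MeasurableSpace Ω] (Pr : Measure Ω) (X : Word → Ω → (Fin d → ℝ))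
    (μm : Measure (Fin d → ℝ)) (f : ℕ → ℕ → (Fin d → ℝ) → ℝ) (p : ℕ → ℕ)
    (n : ℕ) (i : Word) (ω : Ω) : ℝ :=
  Nni X μm f p n i ω - (Pr[Nni X μm f p n i | Fsig X i]) ω

/-- A bounded measurable real function. -/
structure BddMeas {α : Type*} [MeasurableSpace α] (f : α → ℝ) : Prop where
  measurable : Measurable f
  bounded : ∃ C, ∀ y, |f y| ≤ C

namespace BddMeas

variable {α β : Type*} [MeasurableSpace α] [MeasurableSpace β]

lemma comp {f : α → ℝ} (hf : BddMeas f) {φ : β → α} (hφ : Measurable φ) :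
    BddMeas fun y => f (φ y) :=
  ⟨hf.measurable.comp hφ, hf.bounded.imp fun _ hC y => hC (φ y)⟩

lemma const (c : ℝ) : BddMeas fun _ : α => c := ⟨measurable_const, |c|, fun _ => le_rfl⟩

lemma add {f g : α → ℝ} (hf : BddMeas f) (hg : BddMeas g) : BddMeas fun y => f y + g y := by
  obtain ⟨C, hC⟩ := hf.bounded
  obtain ⟨D, hD⟩ := hg.bounded
  exact ⟨hf.measurable.add hg.measurable, C + D,
    fun y => (abs_add_le _ _).trans (add_le_add (hC y) (hD y))⟩

lemma mul {f g : α → ℝ} (hf : BddMeas f) (hg : BddMeas g) : BddMeas fun y => f y * g y := by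
  obtain ⟨C, hC⟩ := hf.bounded
  obtain ⟨D, hD⟩ := hg.bounded
  refine ⟨hf.measurable.mul hg.measurable, C * D, fun y => ?_⟩
  rw [abs_mul]
  exact mul_le_mul (hC y) (hD y) (abs_nonneg _) ((abs_nonneg _).trans (hC y))

lemma const_mul (c : ℝ) {f : α → ℝ} (hf : BddMeas f) : BddMeas fun y => c * f y :=
  (const c).mul hf

lemma sum {ι : Type*} (s : Finset ι) {f : ι → α → ℝ} (hf : ∀ i, BddMeas (f i)) :
    BddMeas fun y => ∑ i ∈ s, f i y := by
  classical
  induction s using Finset.induction_on with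
  | empty => simpa using const (α := α) 0
  | insert a s ha ih => simpa [Finset.sum_insert ha] using (hf a).add ih

lemma integrable {f : α → ℝ} (hf : BddMeas f) (μ : Measure α) [IsFiniteMeasure μ] :
    Integrable f μ := by
  obtain ⟨C, hC⟩ := hf.bounded
  exact Integrable.of_bound hf.measurable.aestronglyMeasurable C (ae_of_all _ hC)

lemma pop {P : Kernel (Fin d → ℝ) ((Fin d → ℝ) × (Fin d → ℝ))} [IsMarkovKernel P]
    {h : (Fin d → ℝ) × (Fin d → ℝ) → ℝ} (hh : BddMeas h) : BddMeas (Pop P h) := by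
  obtain ⟨C, hC⟩ := hh.bounded
  refine ⟨(hh.measurable.stronglyMeasurable.integral_kernel (κ := P)).measurable, C,
    fun x => ?_⟩
  have := norm_integral_le_of_norm_le_const (μ := P x) (f := h) (ae_of_all _ hC)
  simpa [Pop] using this

lemma fst_add_snd {f : α → ℝ} (hf : BddMeas f) : BddMeas fun p : α × α => f p.1 + f p.2 :=
  (hf.comp measurable_fst).add (hf.comp measurable_snd)

end BddMeas

lemma Pop_fst_add_snd (P : Kernel (Fin d → ℝ) ((Fin d → ℝ) × (Fin d → ℝ)))
    (f : (Fin d → ℝ) → ℝ) : Pop P (fun p => f p.1 + f p.2) = fun y => 2 * Qop P f y := by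
  funext y
  simp only [Pop, Qop]
  ring

lemma BddMeas.qop {P : Kernel (Fin d → ℝ) ((Fin d → ℝ) × (Fin d → ℝ))} [IsMarkovKernel P]
    {f : (Fin d → ℝ) → ℝ} (hf : BddMeas f) : BddMeas (Qop P f) := by
  have h := (hf.fst_add_snd.pop (P := P)).const_mul (1 / 2)
  rw [Pop_fst_add_snd] at h
  simpa using h

lemma BddMeas.iterate_qop {P : Kernel (Fin d → ℝ) ((Fin d → ℝ) × (Fin d → ℝ))}
    [IsMarkovKernel P] (r : ℕ) {f : (Fin d → ℝ) → ℝ} (hf : BddMeas f) :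
    BddMeas ((Qop P)^[r] f) := by
  induction r generalizing f with
  | zero => exact hf
  | succ r ih => exact ih hf.qop

lemma mem_gen {k : ℕ} {i : Word} : i ∈ gen k ↔ i.length = k := by
  simp only [gen, Finset.mem_image, Finset.mem_univ, true_and]
  constructor
  · rintro ⟨f, rfl⟩
    simp
  · rintro rfl
    exact ⟨i.get, List.ofFn_get i⟩

lemma gen_zero : gen 0 = {[]} := by
  ext i
  simp [mem_gen]

lemma sum_gen_succ (k : ℕ) (F : Word → ℝ) :
    ∑ i ∈ gen (k + 1), F i = ∑ i ∈ gen k, (F (i ++ [false]) + F (i ++ [true])) := by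
  have h : gen (k + 1) =
      (gen k).image (fun i => i ++ [false]) ∪ (gen k).image (fun i => i ++ [true]) := by
    ext i
    simp only [mem_gen, Finset.mem_union, Finset.mem_image]
    constructor
    · intro hi
      rcases List.eq_nil_or_concat i with rfl | ⟨l, b, rfl⟩
      · simp at hi
      · cases b
        · exact Or.inl ⟨l, by simpa using hi, by simp⟩
        · exact Or.inr ⟨l, by simpa using hi, by simp⟩
    · rintro (⟨l, hl, rfl⟩ | ⟨l, hl, rfl⟩) <;> simp [hl]
  have hd : Disjoint ((gen k).image fun i => i ++ [false])
      ((gen k).image fun i => i ++ [true]) := by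
    rw [Finset.disjoint_left]
    simp only [Finset.mem_image]
    rintro _ ⟨l, -, rfl⟩ ⟨l', -, h'⟩
    simp at h'
  rw [h, Finset.sum_union hd, Finset.sum_image (by simp), Finset.sum_image (by simp),
    Finset.sum_add_distrib]

lemma MA_succ {Ω : Type*} (X : Word → Ω → (Fin d → ℝ)) (k : ℕ) (f : (Fin d → ℝ) → ℝ) (ω : Ω) :
    MA X (gen (k + 1)) f ω =
      ∑ i ∈ gen k, (f (X (i ++ [false]) ω) + f (X (i ++ [true]) ω)) :=
  sum_gen_succ k fun i => f (X i ω)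

lemma MA_const_mul {Ω : Type*} (X : Word → Ω → (Fin d → ℝ)) (A : Finset Word) (c : ℝ)
    (f : (Fin d → ℝ) → ℝ) (ω : Ω) : MA X A (fun y => c * f y) ω = c * MA X A f ω := by
  simp [MA, Finset.mul_sum]

section Chain

variable {Ω : Type*} [MeasurableSpace Ω] {X : Word → Ω → (Fin d → ℝ)}

lemma BddMeas.MA (hX : ∀ i, Measurable (X i)) (A : Finset Word) {f : (Fin d → ℝ) → ℝ}
    (hf : BddMeas f) : BddMeas (MA X A f) :=
  BddMeas.sum A fun i => hf.comp (hX i)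

lemma measurable_sigmaUpTo {k : ℕ} {i : Word} (hi : i ∈ tree k) :
    Measurable[sigmaUpTo X k] (X i) :=
  measurable_iff_comap_le.2 (le_iSup₂_of_le i hi le_rfl)

lemma stronglyMeasurable_MA {m k : ℕ} (hmk : m ≤ k) {f : (Fin d → ℝ) → ℝ}
    (hf : Measurable f) : StronglyMeasurable[sigmaUpTo X k] (MA X (gen m) f) := by
  refine Measurable.stronglyMeasurable ?_
  refine Finset.measurable_fun_sum _ fun i hi => hf.comp (measurable_sigmaUpTo ?_)
  exact Finset.mem_biUnion.2 ⟨m, Finset.mem_range.2 (by omega), hi⟩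

lemma sigmaUpTo_le (hX : ∀ i, Measurable (X i)) (k : ℕ) :
    sigmaUpTo X k ≤ (inferInstance : MeasurableSpace Ω) :=
  iSup₂_le fun i _ => (hX i).comap_le

variable {Pr : Measure Ω}
  {P : Kernel (Fin d → ℝ) ((Fin d → ℝ) × (Fin d → ℝ))} [IsMarkovKernel P]
  {ν : Measure (Fin d → ℝ)}

lemma measurable_children (hX : ∀ i, Measurable (X i)) (i : Word) :
    Measurable fun ω => (X (i ++ [false]) ω, X (i ++ [true]) ω) :=
  (hX _).prodMk (hX _)

/-- Branching property for one vertex. -/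
lemma IsBMC.condExp_children (hB : IsBMC Pr X ν P) {k : ℕ} {i : Word} (hi : i ∈ gen k)
    {h : (Fin d → ℝ) × (Fin d → ℝ) → ℝ} (hh : BddMeas h) :
    Pr[fun ω => h (X (i ++ [false]) ω, X (i ++ [true]) ω) | sigmaUpTo X k]
      =ᵐ[Pr] fun ω => Pop P h (X i ω) := by
  classical
  have key := hB.branching k (fun l _ y z => if l = i then h (y, z) else 1) ?_ ?_
  · convert key using 2
    · funext ω
      simp [Finset.prod_ite_eq', hi]
    · rename_i ω
      rw [Finset.prod_eq_single_of_mem i hi]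
      · simp [Pop]
      · intro j _ hj
        simp [hj]
  · intro l
    by_cases hl : l = i
    · simpa [hl] using (hh.comp measurable_snd).measurable
    · simp [hl]
  · intro l
    obtain ⟨C, hC⟩ := hh.bounded
    by_cases hl : l = i
    · exact ⟨C, fun _ y z => by simpa [hl] using hC (y, z)⟩
    · exact ⟨1, by simp [hl]⟩

variable [IsProbabilityMeasure Pr]

lemma IsBMC.integral_mul_children (hB : IsBMC Pr X ν P) {k : ℕ} {i : Word} (hi : i ∈ gen k)
    {h : (Fin d → ℝ) × (Fin d → ℝ) → ℝ} (hh : BddMeas h) {Z : Ω → ℝ} (hZ : BddMeas Z)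
    (hZk : StronglyMeasurable[sigmaUpTo X k] Z) :
    ∫ ω, Z ω * h (X (i ++ [false]) ω, X (i ++ [true]) ω) ∂Pr =
      ∫ ω, Z ω * Pop P h (X i ω) ∂Pr := by
  have hc := hh.comp (measurable_children hB.meas i)
  rw [← integral_condExp (sigmaUpTo_le hB.meas k)]
  refine integral_congr_ae ?_
  have h1 := condExp_mul_of_stronglyMeasurable_left (μ := Pr) hZk
    ((hZ.mul hc).integrable Pr) (hc.integrable Pr)
  filter_upwards [h1, hB.condExp_children hi hh] with ω h1 h2
  exact h1.trans (by simp only [Pi.mul_apply, h2])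

/-- Conditional independence of the offspring of two distinct vertices of a generation. -/
lemma IsBMC.integral_children_mul_children (hB : IsBMC Pr X ν P) {k : ℕ} {i j : Word}
    (hi : i ∈ gen k) (hj : j ∈ gen k) (hij : i ≠ j)
    {u v : (Fin d → ℝ) × (Fin d → ℝ) → ℝ} (hu : BddMeas u) (hv : BddMeas v) :
    ∫ ω, u (X (i ++ [false]) ω, X (i ++ [true]) ω) *
        v (X (j ++ [false]) ω, X (j ++ [true]) ω) ∂Pr =
      ∫ ω, Pop P u (X i ω) * Pop P v (X j ω) ∂Pr := by
  classical
  have key := hB.branching k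
    (fun l _ y z => if l = i then u (y, z) else if l = j then v (y, z) else 1) ?_ ?_
  · have hint := integral_congr_ae key
    rw [integral_condExp (sigmaUpTo_le hB.meas k)] at hint
    convert hint using 2
    · funext ω
      rw [Finset.prod_eq_mul_of_mem i j hi hj hij]
      · simp [hij.symm]
      · rintro c - ⟨hci, hcj⟩
        simp [hci, hcj]
    · funext ω
      rw [Finset.prod_eq_mul_of_mem i j hi hj hij]
      · simp [hij.symm, Pop]
      · rintro c - ⟨hci, hcj⟩
        simp [hci, hcj]
  · intro l
    by_cases hl : l = i
    · simpa [hl] using (hu.comp measurable_snd).measurable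
    · by_cases hl' : l = j
      · simpa [hl', hij.symm] using (hv.comp measurable_snd).measurable
      · simp [hl, hl']
  · intro l
    obtain ⟨C, hC⟩ := hu.bounded
    obtain ⟨D, hD⟩ := hv.bounded
    by_cases hl : l = i
    · exact ⟨C, fun _ y z => by simpa [hl] using hC (y, z)⟩
    · by_cases hl' : l = j
      · exact ⟨D, fun _ y z => by simpa [hl', hij.symm] using hD (y, z)⟩
      · exact ⟨1, by simp [hl, hl']⟩

lemma IsBMC.integral_mul_MA_succ (hB : IsBMC Pr X ν P) (k : ℕ) {f : (Fin d → ℝ) → ℝ}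
    (hf : BddMeas f) {Z : Ω → ℝ} (hZ : BddMeas Z)
    (hZk : StronglyMeasurable[sigmaUpTo X k] Z) :
    ∫ ω, Z ω * MA X (gen (k + 1)) f ω ∂Pr = 2 * ∫ ω, Z ω * MA X (gen k) (Qop P f) ω ∂Pr := by
  simp only [MA_succ]
  simp only [MA, Finset.mul_sum]
  rw [integral_finsetSum _ fun i _ => (hZ.mul
      (hf.fst_add_snd.comp (measurable_children hB.meas i))).integrable Pr,
    integral_finsetSum _ fun i _ => (hZ.mul (hf.qop.comp (hB.meas i))).integrable Pr,
    Finset.mul_sum]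
  refine Finset.sum_congr rfl fun i hi => ?_
  rw [hB.integral_mul_children hi hf.fst_add_snd hZ hZk, Pop_fst_add_snd,
    ← integral_const_mul]
  congr 1 with ω
  ring

/-- The many-to-one formula for first moments. -/
lemma IsBMC.integral_MA {x : Fin d → ℝ} (hB : IsBMC Pr X (Measure.dirac x) P) (k : ℕ)
    {f : (Fin d → ℝ) → ℝ} (hf : BddMeas f) :
    ∫ ω, MA X (gen k) f ω ∂Pr = 2 ^ k * (Qop P)^[k] f x := by
  induction k generalizing f with
  | zero =>
    simp only [gen_zero, MA, Finset.sum_singleton]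
    rw [← integral_map (hB.meas []).aemeasurable hf.measurable.aestronglyMeasurable, hB.init,
      integral_dirac]
    simp
  | succ k ih =>
    have h := hB.integral_mul_MA_succ k hf (BddMeas.const 1) stronglyMeasurable_const
    simp only [one_mul] at h
    rw [h, ih hf.qop, Function.iterate_succ_apply, pow_succ]
    ring

/-- Second moments of sums over the offspring of a generation. -/
lemma IsBMC.integral_sum_children_mul (hB : IsBMC Pr X ν P) (k : ℕ)
    {u v : (Fin d → ℝ) × (Fin d → ℝ) → ℝ} (hu : BddMeas u) (hv : BddMeas v) :
    ∫ ω, (∑ i ∈ gen k, u (X (i ++ [false]) ω, X (i ++ [true]) ω)) *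
        (∑ j ∈ gen k, v (X (j ++ [false]) ω, X (j ++ [true]) ω)) ∂Pr =
      (∫ ω, MA X (gen k) (Pop P u) ω * MA X (gen k) (Pop P v) ω ∂Pr) -
        (∫ ω, MA X (gen k) (fun y => Pop P u y * Pop P v y) ω ∂Pr) +
        ∫ ω, MA X (gen k) (Pop P fun p => u p * v p) ω ∂Pr := by
  classical
  have hpu : BddMeas (Pop P u) := hu.pop
  have hpv : BddMeas (Pop P v) := hv.pop
  have hpuv : BddMeas (Pop P fun p => u p * v p) := (hu.mul hv).pop
  have hc := measurable_children hB.meas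
  simp only [MA, Finset.sum_mul_sum]
  rw [integral_finsetSum _ fun i _ => (BddMeas.sum _ fun j =>
      (hu.comp (hc i)).mul (hv.comp (hc j))).integrable Pr,
    integral_finsetSum _ fun i _ => (BddMeas.sum _ fun j =>
      (hpu.comp (hB.meas i)).mul (hpv.comp (hB.meas j))).integrable Pr,
    integral_finsetSum _ fun i _ => ((hpu.mul hpv).comp (hB.meas i)).integrable Pr,
    integral_finsetSum _ fun i _ => (hpuv.comp (hB.meas i)).integrable Pr,
    ← Finset.sum_sub_distrib, ← Finset.sum_add_distrib]
  refine Finset.sum_congr rfl fun i hi => ?_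
  rw [integral_finsetSum _ fun j _ => ((hu.comp (hc i)).mul (hv.comp (hc j))).integrable Pr,
    integral_finsetSum _ fun j _ =>
      ((hpu.comp (hB.meas i)).mul (hpv.comp (hB.meas j))).integrable Pr,
    ← Finset.add_sum_erase _ _ hi, ← Finset.add_sum_erase (gen k)
      (fun j => ∫ ω, Pop P u (X i ω) * Pop P v (X j ω) ∂Pr) hi,
    Finset.sum_congr rfl fun j hj => hB.integral_children_mul_children hi
      (Finset.mem_of_mem_erase hj) (Finset.ne_of_mem_erase hj).symm hu hv]
  have hdiag := hB.integral_mul_children hi (hu.mul hv) (BddMeas.const 1)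
    stronglyMeasurable_const
  simp only [one_mul] at hdiag
  rw [hdiag]
  ring

/-- The symmetrised tensor product of two functions. -/
def symTensor (a b : (Fin d → ℝ) → ℝ) (q : (Fin d → ℝ) × (Fin d → ℝ)) : ℝ :=
  (a q.1 * b q.2 + a q.2 * b q.1) / 2

lemma BddMeas.symTensor {a b : (Fin d → ℝ) → ℝ} (ha : BddMeas a) (hb : BddMeas b) :
    BddMeas (symTensor a b) := by
  have h := (((ha.comp measurable_fst).mul (hb.comp measurable_snd)).add
    ((ha.comp measurable_snd).mul (hb.comp measurable_fst))).const_mul (1 / 2)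
  convert h using 1
  funext q
  simp only [BMC.symTensor]
  ring

lemma Pop_fst_add_snd_mul {a b : (Fin d → ℝ) → ℝ} (ha : BddMeas a) (hb : BddMeas b) :
    Pop P (fun p => (a p.1 + a p.2) * (b p.1 + b p.2)) =
      fun y => 2 * Qop P (fun z => b z * a z) y + 2 * Pop P (symTensor b a) y := by
  have h := Pop_fst_add_snd P fun z => b z * a z
  funext y
  rw [← congrFun h y]
  simp only [Pop]
  rw [← integral_const_mul, ← integral_add ((hb.mul ha).fst_add_snd.integrable _)
    (((hb.symTensor ha).integrable _).const_mul 2)]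
  congr 1 with p
  simp only [symTensor]
  ring

lemma IsBMC.integral_MA_succ_mul {x : Fin d → ℝ} (hB : IsBMC Pr X (Measure.dirac x) P) (k : ℕ)
    {a b : (Fin d → ℝ) → ℝ} (ha : BddMeas a) (hb : BddMeas b) :
    ∫ ω, MA X (gen (k + 1)) a ω * MA X (gen (k + 1)) b ω ∂Pr =
      4 * (∫ ω, MA X (gen k) (Qop P a) ω * MA X (gen k) (Qop P b) ω ∂Pr) -
        4 * (2 ^ k * (Qop P)^[k] (fun y => Qop P b y * Qop P a y) x) +
        2 * (2 ^ k * (Qop P)^[k + 1] (fun y => b y * a y) x) +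
        2 * (2 ^ k * (Qop P)^[k] (Pop P (symTensor b a)) x) := by
  have hQ : BddMeas (Qop P fun z => b z * a z) := (hb.mul ha).qop
  have hS : BddMeas (Pop P (symTensor b a)) := (hb.symTensor ha).pop
  simp only [MA_succ]
  rw [hB.integral_sum_children_mul k ha.fst_add_snd hb.fst_add_snd, Pop_fst_add_snd_mul ha hb,
    Pop_fst_add_snd, Pop_fst_add_snd, Function.iterate_succ_apply, ← hB.integral_MA k hQ,
    ← hB.integral_MA k hS, ← hB.integral_MA k (hb.qop.mul ha.qop), ← integral_const_mul,
    ← integral_const_mul, ← integral_const_mul, ← integral_const_mul, add_assoc,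
    ← integral_add ((hQ.MA hB.meas _).const_mul 2 |>.integrable Pr)
      ((hS.MA hB.meas _).const_mul 2 |>.integrable Pr)]
  congr 1
  · congr 1
    · congr 1 with ω
      rw [MA_const_mul, MA_const_mul]
      ring
    · congr 1 with ω
      rw [← MA_const_mul]
      simp only [MA]
      exact Finset.sum_congr rfl fun i _ => by ring
  · congr 1 with ω
    rw [← MA_const_mul, ← MA_const_mul]
    simp only [MA, Finset.sum_add_distrib]

/-- The many-to-one formula for second moments within one generation. -/
lemma IsBMC.integral_MA_mul_MA {x : Fin d → ℝ} (hB : IsBMC Pr X (Measure.dirac x) P) (m : ℕ)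
    {a b : (Fin d → ℝ) → ℝ} (ha : BddMeas a) (hb : BddMeas b) :
    ∫ ω, MA X (gen m) a ω * MA X (gen m) b ω ∂Pr =
      2 ^ m * (Qop P)^[m] (fun y => b y * a y) x +
        ∑ k ∈ Finset.range m, 2 ^ (m + k) * (Qop P)^[m - k - 1]
          (Pop P (symTensor ((Qop P)^[k] b) ((Qop P)^[k] a))) x := by
  induction m generalizing a b with
  | zero =>
    have h := hB.integral_MA 0 (hb.mul ha)
    simp only [gen_zero, MA, Finset.sum_singleton] at h ⊢
    simpa [mul_comm] using h
  | succ m ih =>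
    rw [hB.integral_MA_succ_mul m ha hb, ih ha.qop hb.qop, Finset.sum_range_succ', mul_add,
      Finset.mul_sum]
    have hs : ∀ k ∈ Finset.range m,
        4 * (2 ^ (m + k) * (Qop P)^[m - k - 1]
          (Pop P (symTensor ((Qop P)^[k] (Qop P b)) ((Qop P)^[k] (Qop P a)))) x) =
        2 ^ (m + 1 + (k + 1)) * (Qop P)^[m + 1 - (k + 1) - 1]
          (Pop P (symTensor ((Qop P)^[k + 1] b) ((Qop P)^[k + 1] a))) x := by
      intro k _
      rw [Nat.add_sub_add_right, Function.iterate_succ_apply, Function.iterate_succ_apply]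
      ring
    rw [Finset.sum_congr rfl hs]
    simp only [Nat.sub_zero, Nat.add_sub_cancel, Function.iterate_zero_apply, add_zero]
    ring

lemma IsBMC.integral_mul_MA_add (hB : IsBMC Pr X ν P) (k r : ℕ) {f : (Fin d → ℝ) → ℝ}
    (hf : BddMeas f) {g : (Fin d → ℝ) → ℝ} (hg : BddMeas g) :
    ∫ ω, MA X (gen k) g ω * MA X (gen (k + r)) f ω ∂Pr =
      2 ^ r * ∫ ω, MA X (gen k) g ω * MA X (gen k) ((Qop P)^[r] f) ω ∂Pr := by
  induction r generalizing f with
  | zero => simp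
  | succ r ih =>
    rw [← add_assoc, hB.integral_mul_MA_succ (k + r) hf (hg.MA hB.meas _)
      (stronglyMeasurable_MA (Nat.le_add_right k r) hg.measurable), ih hf.qop,
      Function.iterate_succ_apply]
    ring

end Chain

/-- Lemma 6.2 (eq. (6.3)): many-to-one formula for mixed second moments. -/
theorem many_to_one_mixed_moments
    {d : ℕ} (hd : 1 ≤ d)
    {Ω : Type*} [MeasurableSpace Ω] (Pr : Measure Ω) [IsProbabilityMeasure Pr]
    (X : Word → Ω → (Fin d → ℝ))
    (P : Kernel (Fin d → ℝ) ((Fin d → ℝ) × (Fin d → ℝ))) [IsMarkovKernel P]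
    (x : Fin d → ℝ) (hBMC : IsBMC Pr X (Measure.dirac x) P)
    (f g : (Fin d → ℝ) → ℝ) (hfm : Measurable f) (hfb : ∃ C, ∀ y, |f y| ≤ C)
    (hgm : Measurable g) (hgb : ∃ C, ∀ y, |g y| ≤ C)
    (n m : ℕ) (hmn : m ≤ n) :
    (∫ ω, MA X (gen n) f ω * MA X (gen m) g ω ∂Pr) =
      2 ^ n * (Qop P)^[m] (fun y => g y * (Qop P)^[n - m] f y) x +
        ∑ k ∈ Finset.range m, 2 ^ (n + k) *
          (Qop P)^[m - k - 1]
            (Pop P (fun q =>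
              ((Qop P)^[k] g q.1 * (Qop P)^[n - m + k] f q.2 +
                (Qop P)^[k] g q.2 * (Qop P)^[n - m + k] f q.1) / 2)) x := by
  have hf : BddMeas f := ⟨hfm, hfb⟩
  have hg : BddMeas g := ⟨hgm, hgb⟩
  obtain ⟨r, rfl⟩ := Nat.exists_eq_add_of_le hmn
  have h := hBMC.integral_mul_MA_add m r hf hg
  simp only [mul_comm (MA X (gen m) g _)] at h
  rw [h, hBMC.integral_MA_mul_MA m (hf.iterate_qop r) hg, mul_add, Finset.mul_sum,
    Nat.add_sub_cancel_left]
  congr 1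
  · ring
  · refine Finset.sum_congr rfl fun k _ => ?_
    rw [← Function.iterate_add_apply, add_comm k r, show m + r + k = r + (m + k) by ring,
      pow_add 2 r, mul_assoc]
    rfl

end BMC
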